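/- The Heffter cellulation is closed: for any two distinct elements x, y ∈ F, there are exactly two elements s ∈ F such that {x,y} occurs as an unordered pair of consecutive vertices of the polygon F(s), i.e. such that there exists k ∈ ℤ with {v(s,k), v(s,k+1)} = {x,y}. Hence every edge of the Heffter cellulation lies in exactly two of the q polygons. -/

import Mathlib

/-- Heffter's vertex function: `v(s,k) = s + (α^k - 1)/(α - 1)`. -/
noncomputable def heffterV {F : Type*} [Field F] (α s : F) (k : ℤ) : F :=
  s + (α ^ k - 1) / (α - 1)

theorem heffterV_add_one {F : Type*} [Field F] {α : F} (h0 : α ≠ 0) (h1 : α ≠ 1) (s : F) (k : ℤ) :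
    heffterV α s (k + 1) = heffterV α s k + α ^ k := by
  have h : α - 1 ≠ 0 := sub_ne_zero.mpr h1
  unfold heffterV
  rw [zpow_add_one₀ h0]
  field_simp
  ring

/-- The polygon based at `s` runs along the oriented edge from `x` to `y` for exactly one `s`. -/
theorem exists_heffterV_eq_iff {F : Type*} [Field F] {α : F} (h0 : α ≠ 0) (h1 : α ≠ 1)
    (hα : ∀ x : F, x ≠ 0 → ∃ k : ℤ, α ^ k = x) {x y : F} (hxy : x ≠ y) (s : F) :
    (∃ k : ℤ, heffterV α s k = x ∧ heffterV α s (k + 1) = y) ↔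
      s = x - (y - x - 1) / (α - 1) := by
  simp only [heffterV_add_one h0 h1]
  constructor
  · rintro ⟨k, rfl, rfl⟩
    simp [heffterV]
  · rintro rfl
    obtain ⟨k, hk⟩ := hα (y - x) (sub_ne_zero.mpr hxy.symm)
    exact ⟨k, by simp [heffterV, hk], by simp [heffterV, hk]⟩

/-- A generator of the units of a field with more than three elements is not `0`, `1` or `-1`. -/
theorem generator_ne {F : Type*} [Field F] [Fintype F] (hcard : 3 < Fintype.card F) {α : F}
    (hα : ∀ x : F, x ≠ 0 → ∃ k : ℤ, α ^ k = x) : α ≠ 0 ∧ α ≠ 1 ∧ α ≠ -1 := by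
  classical
  by_contra! h
  have hmem : ∀ x : F, x ∈ ({0, 1, -1} : Finset F) := by
    intro x
    simp only [Finset.mem_insert, Finset.mem_singleton]
    by_cases hx : x = 0
    · exact Or.inl hx
    obtain ⟨k, rfl⟩ := hα x hx
    by_cases h0 : α = 0
    · subst h0
      rw [zero_zpow_eq]
      split_ifs <;> simp
    by_cases h1 : α = 1
    · simp [h1]
    rw [h h0 h1]
    rcases Int.even_or_odd k with hk | hk
    · simp [hk.neg_one_zpow]
    · simp [hk.neg_one_zpow]
  have hle : Fintype.card F ≤ ({0, 1, -1} : Finset F).card :=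
    Finset.card_le_card fun x _ => hmem x
  exact absurd (hle.trans Finset.card_le_three) hcard.not_ge

theorem heffter_closed {F : Type*} [Field F] [Fintype F] (q : ℕ)
    (hcard : Fintype.card F = q) (hq4 : q % 4 = 1) (hq5 : 5 ≤ q)
    (α : F) (hα : ∀ x : F, x ≠ 0 → ∃ k : ℤ, α ^ k = x) :
    ∀ x y : F, x ≠ y →
      {s : F | ∃ k : ℤ,
        ({heffterV α s k, heffterV α s (k + 1)} : Set F) = {x, y}}.ncard = 2 := by
  intro x y hxy
  obtain ⟨h0, h1, h2⟩ := generator_ne (by omega) hα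
  have hset : {s : F | ∃ k : ℤ,
        ({heffterV α s k, heffterV α s (k + 1)} : Set F) = {x, y}} =
      {x - (y - x - 1) / (α - 1), y - (x - y - 1) / (α - 1)} := by
    ext s
    simp only [Set.mem_ofPred_eq, Set.mem_insert_iff, Set.mem_singleton_iff, Set.pair_eq_pair_iff,
      exists_or, exists_heffterV_eq_iff h0 h1 hα hxy, exists_heffterV_eq_iff h0 h1 hα hxy.symm]
  rw [hset]
  refine Set.ncard_pair fun h => h2 ?_
  have h3 : α - 1 ≠ 0 := sub_ne_zero.mpr h1
  field_simp at h
  have h4 : (x - y) * (α + 1) = 0 := by linear_combination h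
  exact eq_neg_of_add_eq_zero_left ((mul_eq_zero.mp h4).resolve_left (sub_ne_zero.mpr hxy))
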